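/- Fix reals t, v*, p̃ with t > 0 and 0 ≤ p̃ ≤ 5t/4. Then the pair (q_N, q_NN) with q_NN = v* − t/2 and q_N = q_NN + p̃/5 is feasible and maximizes π_G over the feasible set; in particular the optimal subscription-fee difference is Δq = −p̃/5. -/

import Mathlib

/-- Content provider's stage-2 payoff. -/
noncomputable def piG (t ptil qN qNN : ℝ) : ℝ :=
  (qNN - ptil) * (1 / 2 - (qNN - qN - ptil) / (6 * t)) +
    qN * (1 / 2 + (qNN - qN - ptil) / (6 * t))

/-- Full-coverage feasibility constraints for the content provider. -/
def Feasible (t vstar ptil qN qNN : ℝ) : Prop :=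
  (qNN - qN ≥ ptil →
    qN ≤ vstar - t / 2 ∧ qNN ≤ vstar - t / 2 + (qNN - qN - ptil) / 6) ∧
  (qNN - qN ≤ ptil →
    qNN ≤ vstar - t / 2 ∧ qN ≤ vstar - t / 2 - (qNN - qN - ptil) / 6)

/-- The payoff in terms of the sum of the fees and the net fee difference. -/
theorem piG_eq (t ptil qN qNN : ℝ) :
    piG t ptil qN qNN = (qNN + qN - ptil) / 2 - (qNN - qN - ptil) ^ 2 / (6 * t) := by
  unfold piG
  ring

/-- For 0 ≤ p̃ ≤ 5t/4 the CP's optimum is q_NN = v* − t/2, q_N = q_NN + p̃/5. -/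
theorem cp_optimum_midpos (t vstar ptil : ℝ) (ht : 0 < t)
    (hp1 : 0 ≤ ptil) (hp2 : ptil ≤ 5 * t / 4) :
    let qNN := vstar - t / 2
    let qN := qNN + ptil / 5
    Feasible t vstar ptil qN qNN ∧
    (∀ qN' qNN' : ℝ, Feasible t vstar ptil qN' qNN' →
      piG t ptil qN' qNN' ≤ piG t ptil qN qNN) ∧
    qNN - qN = -ptil / 5 := by
  intro qNN qN
  have hd : qNN - qN = -ptil / 5 := by simp only [qN]; ring
  refine ⟨⟨fun h => ?_, fun h => ?_⟩, fun a b hab => ?_, hd⟩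
  · have : ptil = 0 := by linarith
    constructor <;> simp only [qN, qNN] <;> linarith
  · constructor <;> simp only [qN, qNN] <;> linarith
  · obtain ⟨x, hx⟩ : ∃ x, x = b - a - ptil := ⟨_, rfl⟩
    have hopt : qNN - qN - ptil = -(6 * ptil / 5) := by linarith
    rw [piG_eq, piG_eq, hopt, ← hx]
    have hS : qNN + qN = 2 * (vstar - t / 2) + ptil / 5 := by simp only [qN, qNN]; ring
    rw [hS]
    suffices h : 3 * t * (b + a) - x ^ 2 ≤
        3 * t * (2 * (vstar - t / 2) + ptil / 5) - (6 * ptil / 5) ^ 2 by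
      have h' := div_le_div_of_nonneg_right h (by positivity : (0 : ℝ) ≤ 6 * t)
      have e (S y : ℝ) : (3 * t * S - y ^ 2) / (6 * t) = S / 2 - y ^ 2 / (6 * t) := by
        field_simp
        ring
      rw [e, e] at h'
      rw [neg_sq]
      linarith
    rcases le_total 0 x with h0 | h0
    · obtain ⟨-, hb⟩ := hab.1 (by linarith)
      have hsum : b + a ≤ 2 * (vstar - t / 2) - 2 * x / 3 - ptil := by linarith
      have hmul := mul_le_mul_of_nonneg_left hsum ht.le
      nlinarith [mul_nonneg ht.le h0, mul_nonneg hp1 (sub_nonneg.2 hp2), mul_nonneg ht.le hp1]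
    · obtain ⟨hb, ha⟩ := hab.2 (by linarith)
      rcases le_total x (-(6 * ptil / 5)) with h1 | h1
      · have hsum : b + a ≤ 2 * (vstar - t / 2) + 2 * x / 3 + ptil := by linarith
        have hmul := mul_le_mul_of_nonneg_left hsum ht.le
        have hneg : 0 ≤ 2 * t - x + 6 * ptil / 5 := by linarith
        nlinarith [mul_nonneg (sub_nonneg.2 h1) hneg]
      · have hsum : b + a ≤ 2 * (vstar - t / 2) - x - ptil := by linarith
        have hmul := mul_le_mul_of_nonneg_left hsum ht.le
        have hpos : 0 ≤ 3 * t + x - 6 * ptil / 5 := by linarith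
        nlinarith [mul_nonneg (sub_nonneg.2 h1) hpos]
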